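/- Let q ≥ 4 be a prime power and n ≥ 2, let G = SL(n,q), and let H be a subgroup of G isomorphic (as a group) to SL(2,q). If S is a symmetric generating set of G that contains H, then either S³ = G or |S³| > |S|·q^{1/1000}. -/

import Mathlib

open scoped MatrixGroups Pointwise

/-- A group is `k`-quasirandom if every complex representation on which it acts non-trivially
has dimension at least `k`. -/
def IsQuasirandom (G : Type) [Group G] (k : ℝ) : Prop :=
  ∀ (V : Type) [AddCommGroup V] [Module ℂ V] [FiniteDimensional ℂ V] (ρ : Representation ℂ G V),
    (∃ g, ρ g ≠ 1) → k ≤ Module.finrank ℂ V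

section Spectral

open Module Module.End LinearMap

theorem mul_norm_sq_le_trace_mul_of_le_finrank_eigenspace {E : Type*} [NormedAddCommGroup E]
    [InnerProductSpace ℂ E] [FiniteDimensional ℂ E] (M : E →ₗ[ℂ] E) (k : ℝ)
    (hk : ∀ μ : ℂ, μ ≠ 0 → eigenspace (M.adjoint * M) μ ≠ ⊥ →
      k ≤ finrank ℂ (eigenspace (M.adjoint * M) μ)) (v : E) :
    k * ‖M v‖ ^ 2 ≤ (trace ℂ E (M.adjoint * M)).re * ‖v‖ ^ 2 := by
  set T := M.adjoint * M with hT_def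
  have hT : T.IsSymmetric := fun x y ↦ by
    simp [hT_def, LinearMap.adjoint_inner_left, LinearMap.adjoint_inner_right]
  set b := hT.eigenvectorBasis rfl
  set l := hT.eigenvalues rfl
  have hl (i) : l i = ‖M (b i)‖ ^ 2 := by
    have h1 : inner ℂ (b i) (T (b i)) = (‖M (b i)‖ ^ 2 : ℂ) := by
      simp [hT_def, LinearMap.adjoint_inner_right, inner_self_eq_norm_sq_to_K]
    rw [hT.apply_eigenvectorBasis, inner_smul_right, inner_self_eq_norm_sq_to_K,
      b.orthonormal.1 i] at h1
    simp only [Complex.coe_algebraMap, Complex.ofReal_one, one_pow, mul_one] at h1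
    exact_mod_cast h1
  have hl0 (i) : 0 ≤ l i := by rw [hl]; positivity
  have htr : (trace ℂ E T).re = ∑ i, l i := hT.re_trace_eq_sum_eigenvalues rfl
  have hle (i) : k * l i ≤ (trace ℂ E T).re := by
    rcases eq_or_ne (l i) 0 with h0 | h0
    · rw [h0, mul_zero, htr]
      exact Finset.sum_nonneg fun j _ ↦ hl0 j
    have hne : eigenspace T (l i : ℂ) ≠ ⊥ := hT.hasEigenvalue_eigenvalues rfl i
    have h1 := hk (l i) (by exact_mod_cast h0) hne
    rw [← hT.card_filter_eigenvalues_eq rfl] at h1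
    calc k * l i ≤ _ := mul_le_mul_of_nonneg_right h1 (hl0 i)
      _ = ∑ j with ((l j : ℝ) : ℂ) = l i, l i := by rw [Finset.sum_const, nsmul_eq_mul]; rfl
      _ = ∑ j with ((l j : ℝ) : ℂ) = l i, l j := by
        refine Finset.sum_congr rfl fun j hj ↦ ?_
        exact_mod_cast (Finset.mem_filter.1 hj).2.symm
      _ ≤ ∑ j, l j := Finset.sum_le_sum_of_subset_of_nonneg (Finset.filter_subset _ _)
        fun j _ _ ↦ hl0 j
      _ = _ := htr.symm
  have hMv : ‖M v‖ ^ 2 = ∑ i, l i * ‖b.repr v i‖ ^ 2 := by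
    have h1 : inner ℂ v (T v) = (‖M v‖ ^ 2 : ℂ) := by
      simp [hT_def, LinearMap.adjoint_inner_right, inner_self_eq_norm_sq_to_K]
    rw [← b.repr.inner_map_map, PiLp.inner_apply] at h1
    simp_rw [b, hT.eigenvectorBasis_apply_self_apply] at h1
    have h2 (i) : inner ℂ (b.repr v i) ((l i : ℂ) * b.repr v i)
        = ((l i * ‖b.repr v i‖ ^ 2 : ℝ) : ℂ) := by
      rw [← smul_eq_mul, inner_smul_right, inner_self_eq_norm_sq_to_K]
      simp
    have h3 : ∑ i, inner ℂ (b.repr v i) ((l i : ℂ) * b.repr v i) = (‖M v‖ ^ 2 : ℂ) := h1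
    rw [Finset.sum_congr rfl fun i _ ↦ h2 i] at h3
    exact_mod_cast h3.symm
  have hv : ‖v‖ ^ 2 = ∑ i, ‖b.repr v i‖ ^ 2 := by
    rw [← b.repr.norm_map, EuclideanSpace.norm_sq_eq]
  rw [hMv, hv, Finset.mul_sum, Finset.mul_sum]
  refine Finset.sum_le_sum fun i _ ↦ ?_
  rw [← mul_assoc]
  exact mul_le_mul_of_nonneg_right (hle i) (by positivity)

end Spectral

section Gowers

open Module Module.End

variable {G : Type} [Group G]

/-- The action of `G` on complex functions on `G` by right translation. -/
noncomputable def rightTranslation : Representation ℂ G (EuclideanSpace ℂ G) where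
  toFun g :=
    { toFun v := WithLp.toLp 2 fun x ↦ v (x * g)
      map_add' _ _ := rfl
      map_smul' _ _ := rfl }
  map_one' := by ext; simp
  map_mul' g h := by
    ext v x
    change v (x * (g * h)) = v (x * g * h)
    rw [mul_assoc]

theorem rightTranslation_apply (g : G) (v : EuclideanSpace ℂ G) (x : G) :
    rightTranslation g v x = v (x * g) := rfl

variable [Fintype G] [DecidableEq G]

/-- Convolution from the left by `f` on the space of complex functions on `G`. -/
noncomputable def leftConvolution (f : G → ℂ) : EuclideanSpace ℂ G →ₗ[ℂ] EuclideanSpace ℂ G :=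
  Matrix.toEuclideanLin (Matrix.of fun x y ↦ f (x * y⁻¹))

theorem leftConvolution_apply (f : G → ℂ) (v : EuclideanSpace ℂ G) (x : G) :
    leftConvolution f v x = ∑ y, f (x * y⁻¹) * v y := by
  simp [leftConvolution, Matrix.toLpLin_apply, Matrix.mulVec, dotProduct]

theorem adjoint_leftConvolution (f : G → ℂ) :
    (leftConvolution f).adjoint = leftConvolution fun x ↦ star (f x⁻¹) := by
  rw [leftConvolution, ← Matrix.toEuclideanLin_conjTranspose_eq_adjoint, leftConvolution]
  congr 1
  ext x y
  simp

theorem leftConvolution_rightTranslation (f : G → ℂ) (g : G) (v : EuclideanSpace ℂ G) :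
    leftConvolution f (rightTranslation g v) = rightTranslation g (leftConvolution f v) := by
  ext x
  rw [rightTranslation_apply, leftConvolution_apply, leftConvolution_apply]
  refine Fintype.sum_equiv (Equiv.mulRight g) _ _ fun y ↦ ?_
  simp [rightTranslation_apply, mul_assoc]

theorem trace_adjoint_mul_leftConvolution (f : G → ℂ) :
    (LinearMap.trace ℂ _ ((leftConvolution f).adjoint * leftConvolution f)).re
      = Fintype.card G * ∑ x, ‖f x‖ ^ 2 := by
  rw [LinearMap.trace_eq_sum_inner _ (EuclideanSpace.basisFun G ℂ)]
  have h (x : G) : inner ℂ (EuclideanSpace.basisFun G ℂ x)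
      (((leftConvolution f).adjoint * leftConvolution f) (EuclideanSpace.basisFun G ℂ x))
      = ((∑ x, ‖f x‖ ^ 2 : ℝ) : ℂ) := by
    rw [Module.End.mul_apply, LinearMap.adjoint_inner_right, inner_self_eq_norm_sq_to_K,
      ← RCLike.ofReal_pow, EuclideanSpace.norm_sq_eq]
    congr 1
    refine Fintype.sum_equiv (Equiv.mulRight x⁻¹) _ _ fun y ↦ ?_
    simp [leftConvolution_apply]
  rw [Finset.sum_congr rfl fun x _ ↦ h x, Finset.sum_const, nsmul_eq_mul]
  norm_cast

theorem IsQuasirandom.mul_norm_leftConvolution_sq_le {k : ℝ} (hG : IsQuasirandom G k) (f : G → ℂ)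
    (hf : ∑ x, f x = 0) (v : EuclideanSpace ℂ G) :
    k * ‖leftConvolution f v‖ ^ 2 ≤ (Fintype.card G * ∑ x, ‖f x‖ ^ 2) * ‖v‖ ^ 2 := by
  rw [← trace_adjoint_mul_leftConvolution]
  refine mul_norm_sq_le_trace_mul_of_le_finrank_eigenspace _ _ (fun μ hμ hne ↦ ?_) v
  set T := (leftConvolution f).adjoint * leftConvolution f with hT
  have hcomm (g : G) (v) : T (rightTranslation g v) = rightTranslation g (T v) := by
    simp [hT, adjoint_leftConvolution, leftConvolution_rightTranslation]
  have hinv (g : G) : ∀ v ∈ eigenspace T μ, rightTranslation g v ∈ eigenspace T μ := fun v hv ↦ by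
    rw [mem_eigenspace_iff] at hv ⊢
    rw [hcomm, hv, map_smul]
  let ρ : Representation ℂ G (eigenspace T μ) :=
    { toFun g := (rightTranslation g).restrict (hinv g)
      map_one' := by ext; simp
      map_mul' g h := by ext; simp }
  refine hG _ ρ ?_
  by_contra! htriv
  obtain ⟨w, hw, hw0⟩ := Submodule.exists_mem_ne_zero_of_ne_bot hne
  have hconst (g : G) : w g = w 1 := by
    have h1 := congrArg Subtype.val (LinearMap.congr_fun (htriv g) ⟨w, hw⟩)
    have h2 : rightTranslation g w = w := h1
    have h3 := rightTranslation_apply g w 1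
    rwa [h2, one_mul, eq_comm] at h3
  have hzero : leftConvolution f w = 0 := by
    ext x
    rw [leftConvolution_apply]
    simp_rw [hconst, ← Finset.sum_mul]
    have : ∑ y, f (x * y⁻¹) = ∑ y, f y :=
      Fintype.sum_equiv ((Equiv.inv G).trans (Equiv.mulLeft x)) _ _ fun y ↦ rfl
    rw [this, hf]
    simp
  rw [mem_eigenspace_iff, hT, Module.End.mul_apply, hzero, map_zero, eq_comm, smul_eq_zero] at hw
  exact hw.elim hμ hw0

/-- Gowers' trick: in a quasirandom group, the product of three large sets is everything. -/
theorem IsQuasirandom.mul_mul_eq_univ {k : ℝ} (hG : IsQuasirandom G k) (A B C : Finset G)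
    (h : (Fintype.card G : ℝ) ^ 3 < k * (A.card * B.card * C.card)) :
    A * B * C = Finset.univ := by
  by_contra hne
  obtain ⟨g, hg⟩ : ∃ g, g ∉ A * B * C := by simpa [Finset.eq_univ_iff_forall] using hne
  set N : ℝ := (Fintype.card G : ℝ) with hN
  have hN0 : 0 < N := by simp [hN, Fintype.card_pos]
  set c : ℝ := A.card / N
  set f : G → ℂ := fun x ↦ (if x ∈ A then 1 else 0) - c with hf
  have hf0 : ∑ x, f x = 0 := by
    simp only [hf, Finset.sum_sub_distrib, Finset.sum_ite_mem, Finset.sum_const, Finset.univ_inter,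
      nsmul_eq_mul, mul_one, Finset.card_univ]
    have : N * c = A.card := by simp only [c]; field_simp
    rw [sub_eq_zero]
    exact_mod_cast this.symm
  have hf2 : ∑ x, ‖f x‖ ^ 2 ≤ A.card := by
    have h1 (x) : ‖f x‖ ^ 2 = (if x ∈ A then 1 - 2 * c else 0) + c ^ 2 := by
      have : f x = (((if x ∈ A then 1 else 0) - c : ℝ) : ℂ) := by
        simp only [hf]; split_ifs <;> simp
      rw [this, Complex.norm_real, Real.norm_eq_abs, sq_abs]
      split_ifs <;> ring
    simp_rw [h1, Finset.sum_add_distrib, Finset.sum_ite_mem, Finset.univ_inter, Finset.sum_const,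
      nsmul_eq_mul, Finset.card_univ]
    have h2 : N * c = A.card := by simp only [c]; field_simp
    have h3 : (0 : ℝ) ≤ c * A.card := by positivity
    calc (A.card * (1 - 2 * c) + N * c ^ 2 : ℝ) = A.card - 2 * (c * A.card) + N * c * c := by ring
      _ ≤ A.card := by rw [h2]; linarith
  set v : EuclideanSpace ℂ G := WithLp.toLp 2 fun x ↦ if x ∈ B then 1 else 0 with hv
  set D : Finset G := C.image fun x ↦ g * x⁻¹ with hD
  have hDcard : D.card = C.card := Finset.card_image_of_injective _ fun x y hxy ↦ by simpa using hxy
  set u : EuclideanSpace ℂ G := WithLp.toLp 2 fun x ↦ if x ∈ D then 1 else 0 with hu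
  have hvn : ‖v‖ ^ 2 = B.card := by
    rw [EuclideanSpace.norm_sq_eq]; simp [hv, apply_ite]
  have hun : ‖u‖ ^ 2 = C.card := by
    rw [EuclideanSpace.norm_sq_eq, ← hDcard]; simp [hu, apply_ite]
  have hinner : inner ℂ u (leftConvolution f v) = ((-(c * (B.card * C.card)) : ℝ) : ℂ) := by
    rw [PiLp.inner_apply]
    have h1 (x : G) (hx : x ∈ D) : leftConvolution f v x = -(c * B.card : ℂ) := by
      rw [leftConvolution_apply]
      have h2 (y : G) : f (x * y⁻¹) * v y = if y ∈ B then -(c : ℂ) else 0 := by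
        simp only [hv, hf]
        split_ifs with h3 h4
        · obtain ⟨z, hz, rfl⟩ := Finset.mem_image.1 hx
          refine absurd ?_ hg
          have := Finset.mul_mem_mul (Finset.mul_mem_mul h3 h4) hz
          simpa using this
        all_goals simp
      simp_rw [h2, Finset.sum_ite_mem, Finset.univ_inter, Finset.sum_const, nsmul_eq_mul]
      ring
    have h2 (x : G) : inner ℂ (u x) (leftConvolution f v x)
        = if x ∈ D then -(c * B.card : ℂ) else 0 := by
      by_cases hx : x ∈ D
      · rw [h1 x hx]; simp [hu, hx]
      · simp [hu, hx]
    rw [Finset.sum_congr rfl fun x _ ↦ h2 x, Finset.sum_ite_mem, Finset.univ_inter,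
      Finset.sum_const, nsmul_eq_mul, hDcard]
    push_cast
    ring
  have hcs := norm_inner_le_norm (𝕜 := ℂ) u (leftConvolution f v)
  rw [hinner, Complex.norm_real, norm_neg, Real.norm_eq_abs, abs_of_nonneg (by positivity)] at hcs
  have hcs2 := pow_le_pow_left₀ (by positivity) hcs 2
  rw [mul_pow ‖u‖, hun] at hcs2
  have hk0 : 0 < k := by
    by_contra! hk
    have : k * (A.card * B.card * C.card : ℝ) ≤ 0 :=
      mul_nonpos_of_nonpos_of_nonneg hk (by positivity)
    linarith [pow_pos hN0 3]
  have hmain := hG.mul_norm_leftConvolution_sq_le f hf0 v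
  rw [hvn] at hmain
  have hpos : (0 : ℝ) < A.card * B.card * C.card := by
    by_contra! h0
    have : k * (A.card * B.card * C.card : ℝ) ≤ 0 := mul_nonpos_of_nonneg_of_nonpos hk0.le h0
    linarith [pow_pos hN0 3]
  have hA : (A.card : ℝ) = c * N := by simp only [c]; field_simp
  have hBC : (0 : ℝ) < A.card * (B.card * C.card) := by linarith
  have h1 : k * (c * (B.card * C.card)) ^ 2 ≤ C.card * (N * A.card * B.card) := by
    calc k * (c * (B.card * C.card)) ^ 2 ≤ k * (C.card * ‖leftConvolution f v‖ ^ 2) := by gcongr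
      _ = C.card * (k * ‖leftConvolution f v‖ ^ 2) := by ring
      _ ≤ C.card * ((N * ∑ x, ‖f x‖ ^ 2) * B.card) :=
        mul_le_mul_of_nonneg_left hmain C.card.cast_nonneg
      _ ≤ _ := mul_le_mul_of_nonneg_left (mul_le_mul_of_nonneg_right
        (mul_le_mul_of_nonneg_left hf2 hN0.le) B.card.cast_nonneg) C.card.cast_nonneg
  have h2 : k * (A.card * B.card * C.card) * (A.card * (B.card * C.card))
      ≤ N ^ 3 * (A.card * (B.card * C.card)) := by
    calc k * (A.card * B.card * C.card) * (A.card * (B.card * C.card) : ℝ)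
        = N ^ 2 * (k * (c * (B.card * C.card)) ^ 2) := by rw [hA]; ring
      _ ≤ N ^ 2 * (C.card * (N * A.card * B.card)) := by gcongr
      _ = _ := by ring
  exact absurd (le_of_mul_le_mul_right h2 hBC) (not_le.2 h)

end Gowers

theorem IsQuasirandom.of_mulEquiv {G H : Type} [Group G] [Group H] {k : ℝ}
    (hG : IsQuasirandom G k) (e : G ≃* H) : IsQuasirandom H k := by
  intro V _ _ _ ρ ⟨h, hh⟩
  exact hG V (ρ.comp e.toMonoidHom) ⟨e.symm h, by simpa using hh⟩

theorem Representation.trace_eq_of_isConj {G V : Type*} [Group G] [AddCommGroup V] [Module ℂ V]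
    (ρ : Representation ℂ G V) {g h : G} (hgh : IsConj g h) :
    LinearMap.trace ℂ V (ρ g) = LinearMap.trace ℂ V (ρ h) := by
  obtain ⟨c, rfl⟩ := isConj_iff.1 hgh
  rw [map_mul, LinearMap.trace_mul_comm, ← map_mul, ← mul_assoc, inv_mul_cancel, one_mul]

section CharacterProjection

variable {E V : Type*} [AddCommGroup E] [Fintype E] [AddCommGroup V] [Module ℂ V]

/-- The projection onto the isotypic component of a character of a finite abelian group. -/
noncomputable def charProj (ρ : Representation ℂ (Multiplicative E) V) (χ : AddChar E ℂ) :
    V →ₗ[ℂ] V :=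
  (Fintype.card E : ℂ)⁻¹ • ∑ e, χ (-e) • ρ (.ofAdd e)

variable (ρ : Representation ℂ (Multiplicative E) V) (χ : AddChar E ℂ)

theorem mul_charProj (e : E) : ρ (.ofAdd e) * charProj ρ χ = χ e • charProj ρ χ := by
  simp only [charProj, mul_smul_comm, Finset.mul_sum, ← map_mul, ← ofAdd_add]
  rw [smul_comm (χ e) (Fintype.card E : ℂ)⁻¹, Finset.smul_sum (r := χ e),
    ← Equiv.sum_comp (Equiv.addLeft e) fun x ↦ χ e • χ (-x) • ρ (.ofAdd x)]
  refine congrArg _ (Finset.sum_congr rfl fun x _ ↦ ?_)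
  rw [smul_smul, ← AddChar.map_add_eq_mul]
  simp

theorem isIdempotentElem_charProj : IsIdempotentElem (charProj ρ χ) := by
  have h1 : charProj ρ χ * charProj ρ χ
      = (Fintype.card E : ℂ)⁻¹ • ∑ e, χ (-e) • (ρ (.ofAdd e) * charProj ρ χ) := by
    conv_lhs => enter [1]; rw [charProj]
    simp only [smul_mul_assoc, Finset.sum_mul]
  have h2 (e : E) : χ (-e) * χ e = 1 := by
    rw [← AddChar.map_add_eq_mul, neg_add_cancel, AddChar.map_zero_eq_one]
  rw [IsIdempotentElem, h1]
  simp_rw [mul_charProj, smul_smul, h2, one_smul, Finset.sum_const, Finset.card_univ]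
  rw [← Nat.cast_smul_eq_nsmul ℂ, smul_smul, inv_mul_cancel₀ (by simp), one_smul]

theorem sum_charProj : ∑ χ, charProj ρ χ = 1 := by
  classical
  simp only [charProj]
  rw [← Finset.smul_sum, Finset.sum_comm]
  simp_rw [← Finset.sum_smul, AddChar.sum_apply_eq_ite, neg_eq_zero, ite_smul, zero_smul,
    Finset.sum_ite_eq', Finset.mem_univ, if_true, smul_smul]
  rw [inv_mul_cancel₀ (by simp), one_smul, ofAdd_zero, map_one]

theorem trace_charProj : LinearMap.trace ℂ V (charProj ρ χ)
    = (Fintype.card E : ℂ)⁻¹ * ∑ e, χ (-e) * LinearMap.trace ℂ V (ρ (.ofAdd e)) := by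
  simp [charProj]

variable [FiniteDimensional ℂ V]

theorem trace_charProj_eq_finrank :
    LinearMap.trace ℂ V (charProj ρ χ) = Module.finrank ℂ (charProj ρ χ).range :=
  (LinearMap.IsIdempotentElem.isProj_range _ (isIdempotentElem_charProj ρ χ)).trace

theorem le_finrank_of_trace_charProj_eq (k : ℕ)
    (h : ∀ χ : AddChar E ℂ, χ ≠ 1 → ∃ T : Finset (AddChar E ℂ), k ≤ T.card ∧ ∀ χ' ∈ T,
      LinearMap.trace ℂ V (charProj ρ χ') = LinearMap.trace ℂ V (charProj ρ χ))
    (hρ : ∃ e, ρ e ≠ 1) : k ≤ Module.finrank ℂ V := by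
  classical
  have hsum : Module.finrank ℂ V = ∑ χ, Module.finrank ℂ (charProj ρ χ).range := by
    have := congrArg (LinearMap.trace ℂ V) (sum_charProj ρ)
    rw [map_sum, LinearMap.trace_one] at this
    simp_rw [trace_charProj_eq_finrank] at this
    exact_mod_cast this.symm
  obtain ⟨χ, hχ, hχ0⟩ : ∃ χ : AddChar E ℂ, χ ≠ 1 ∧ charProj ρ χ ≠ 0 := by
    by_contra! h0
    obtain ⟨e, he⟩ := hρ
    have h1 : charProj ρ 1 = 1 := by
      rw [← sum_charProj ρ, Finset.sum_eq_single 1 (fun χ _ hχ ↦ h0 χ hχ) (by simp)]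
    have h2 := mul_charProj ρ 1 e.toAdd
    rw [h1, mul_one, AddChar.one_apply, one_smul] at h2
    exact he h2
  obtain ⟨T, hT, hTχ⟩ := h χ hχ
  have hpos : 0 < Module.finrank ℂ (charProj ρ χ).range := by
    rw [Module.finrank_pos_iff, Submodule.nontrivial_iff_ne_bot]
    rwa [Ne, LinearMap.range_eq_bot]
  calc k ≤ T.card := hT
    _ = ∑ χ' ∈ T, 1 := by simp
    _ ≤ ∑ χ' ∈ T, Module.finrank ℂ (charProj ρ χ').range := by
      refine Finset.sum_le_sum fun χ' hχ' ↦ ?_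
      have := hTχ χ' hχ'
      rw [trace_charProj_eq_finrank, trace_charProj_eq_finrank] at this
      rw [Nat.cast_inj.1 this]
      exact hpos
    _ ≤ _ := by
      rw [hsum]
      exact Finset.sum_le_sum_of_subset (Finset.subset_univ _)

theorem card_sub_one_le_finrank_of_trace_eq (τ : ℂ)
    (hτ : ∀ e : E, e ≠ 0 → LinearMap.trace ℂ V (ρ (.ofAdd e)) = τ) (hρ : ∃ e, ρ e ≠ 1) :
    Fintype.card E - 1 ≤ Module.finrank ℂ V := by
  classical
  have key (χ : AddChar E ℂ) (hχ : χ ≠ 1) : LinearMap.trace ℂ V (charProj ρ χ)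
      = (Fintype.card E : ℂ)⁻¹ * (Module.finrank ℂ V - τ) := by
    rw [trace_charProj]
    have h1 : ∀ e, χ (-e) * LinearMap.trace ℂ V (ρ (.ofAdd e))
        = χ (-e) * τ + if e = 0 then (Module.finrank ℂ V - τ : ℂ) else 0 := fun e ↦ by
      split_ifs with he
      · simp [he]
      · rw [hτ e he, add_zero]
    have h2 : ∑ e, χ (-e) = 0 :=
      (Fintype.sum_equiv (Equiv.neg E) _ _ fun _ ↦ rfl).trans (AddChar.sum_eq_zero_iff_ne_zero.2 hχ)
    simp_rw [h1, Finset.sum_add_distrib, ← Finset.sum_mul, h2]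
    simp
  refine le_finrank_of_trace_charProj_eq ρ _ (fun χ hχ ↦ ⟨Finset.univ.erase 1, ?_, ?_⟩) hρ
  · rw [Finset.card_erase_of_mem (Finset.mem_univ _), Finset.card_univ, AddChar.card_eq]
  · intro χ' hχ'
    rw [key χ hχ, key χ' (Finset.ne_of_mem_erase hχ')]

end CharacterProjection

section SL2

variable {F : Type} [Field F]

open Matrix.SpecialLinearGroup

theorem card_sub_one_le_two_mul_card_image_sq [Fintype F] [DecidableEq F] :
    Fintype.card F - 1 ≤ 2 * ((Finset.univ.erase (0 : F)).image (· ^ 2)).card := by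
  rw [← Finset.card_univ, ← Finset.card_erase_of_mem (Finset.mem_univ (0 : F))]
  refine Finset.card_le_mul_card_image _ _ fun b hb ↦ ?_
  obtain ⟨a, -, rfl⟩ := Finset.mem_image.1 hb
  refine (Finset.card_le_card (t := {a, -a}) fun x hx ↦ ?_).trans Finset.card_le_two
  have := (Finset.mem_filter.1 hx).2
  simpa using sq_eq_sq_iff_eq_or_eq_neg.1 this

/-- The upper unipotent subgroup of `SL(2, F)`. -/
def upperUnipotent : Multiplicative F →* SL(2, F) where
  toFun t := transvection zero_ne_one t.toAdd
  map_one' := by simp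
  map_mul' a b := by simp [transvection_add]

theorem isConj_upperUnipotent (a : F) (ha : a ≠ 0) (t : F) :
    IsConj (upperUnipotent (.ofAdd t)) (upperUnipotent (.ofAdd (a ^ 2 * t))) := by
  refine isConj_iff.2 ⟨diag2 a ha, ?_⟩
  rw [mul_inv_eq_iff_eq_mul]
  ext i j
  fin_cases i <;> fin_cases j <;>
    simp [upperUnipotent, diag2_coe', transvection_coe, Matrix.mul_apply, Fin.sum_univ_two]
  field_simp

theorem isQuasirandom_SL2 [Fintype F] : IsQuasirandom SL(2, F) ((Fintype.card F - 1) / 2) := by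
  classical
  intro V _ _ _ ρ hρ
  set S := (Finset.univ.erase (0 : F)).image (· ^ 2) with hS
  have hcard : S.card ≤ Module.finrank ℂ V := by
    refine le_finrank_of_trace_charProj_eq (ρ.comp upperUnipotent) _ (fun χ hχ ↦ ?_) ?_
    · have hinj := AddChar.to_mulShift_inj_of_isPrimitive (AddChar.IsPrimitive.of_ne_one hχ)
      refine ⟨S.image χ.mulShift, (Finset.card_image_of_injective _ hinj).ge, fun χ' hχ' ↦ ?_⟩
      obtain ⟨b, hb, rfl⟩ := Finset.mem_image.1 hχ'
      obtain ⟨a, ha, rfl⟩ := Finset.mem_image.1 hb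
      have ha0 := Finset.ne_of_mem_erase ha
      rw [trace_charProj, trace_charProj]
      congr 1
      refine Fintype.sum_equiv (Equiv.mulLeft₀ (a ^ 2) (pow_ne_zero 2 ha0)) _ _ fun e ↦ ?_
      have h1 := ρ.trace_eq_of_isConj (isConj_upperUnipotent a ha0 e)
      simp only [AddChar.mulShift_apply, mul_neg]
      exact congrArg _ h1
    · by_contra! h
      have hu (t : F) : ρ (transvection zero_ne_one t) = 1 := h (.ofAdd t)
      obtain ⟨g, hg⟩ := hρ
      refine hg (Matrix.SL2.transvection_induction (fun g ↦ ρ g = 1) (fun i j hij c ↦ ?_)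
        (fun A B hA hB ↦ by rw [map_mul, hA, hB, one_mul]) g)
      fin_cases i <;> fin_cases j
      · exact absurd rfl hij
      · exact hu c
      · change ρ (transvection one_ne_zero c) = 1
        obtain ⟨w, hw⟩ : ∃ w : SL(2, F), (w : Matrix (Fin 2) (Fin 2) F) = !![0, 1; -1, 0] :=
          ⟨⟨_, by simp⟩, rfl⟩
        have hw : w * transvection zero_ne_one (-c) = transvection one_ne_zero c * w := by
          ext i j
          fin_cases i <;> fin_cases j <;>
            simp [hw, transvection_coe, Matrix.mul_apply, Fin.sum_univ_two]
        rw [← mul_inv_eq_iff_eq_mul.2 hw, map_mul, map_mul, hu, mul_one, ← map_mul,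
          mul_inv_cancel, map_one]
      · exact absurd rfl hij
  have h1 := (card_sub_one_le_two_mul_card_image_sq (F := F)).trans
    (Nat.mul_le_mul_left 2 hcard)
  have h2 : (Fintype.card F : ℝ) ≤ 2 * Module.finrank ℂ V + 1 := by
    exact_mod_cast Nat.le_add_of_sub_le h1
  linarith

end SL2

section Transvections

open Matrix

variable {n : ℕ} {F : Type} [Field F]

/-- The transvection `x ↦ x + (φ ⬝ᵥ x) • v`, for `φ ⬝ᵥ v = 0`. -/
def vecTransvection (v φ : Fin n → F) (h : φ ⬝ᵥ v = 0) : SL(n, F) :=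
  ⟨1 + vecMulVec v φ, by
    rw [vecMulVec_eq Unit, det_one_add_replicateCol_mul_replicateRow, h, add_zero]⟩

theorem coe_vecTransvection {v φ : Fin n → F} (h : φ ⬝ᵥ v = 0) :
    (vecTransvection v φ h).1 = 1 + vecMulVec v φ := rfl

theorem vecTransvection_mulVec {v φ : Fin n → F} (h : φ ⬝ᵥ v = 0) (x : Fin n → F) :
    (vecTransvection v φ h).1 *ᵥ x = x + (φ ⬝ᵥ x) • v := by
  rw [coe_vecTransvection, add_mulVec, one_mulVec, vecMulVec_mulVec, op_smul_eq_smul]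

theorem vecMul_vecTransvection {v φ : Fin n → F} (h : φ ⬝ᵥ v = 0) (θ : Fin n → F) :
    θ ᵥ* (vecTransvection v φ h).1 = θ + (θ ⬝ᵥ v) • φ := by
  rw [coe_vecTransvection, vecMul_add, vecMul_one, vecMul_vecMulVec]

theorem vecTransvection_zero_left (φ : Fin n → F) :
    vecTransvection 0 φ (dotProduct_zero φ) = 1 := by
  refine Subtype.ext ?_
  simp [coe_vecTransvection]

theorem vecTransvection_zero_right (v : Fin n → F) :
    vecTransvection v 0 (zero_dotProduct v) = 1 := by
  refine Subtype.ext ?_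
  simp [coe_vecTransvection]

theorem vecTransvection_mul_left {v v' φ : Fin n → F} (h : φ ⬝ᵥ v = 0) (h' : φ ⬝ᵥ v' = 0) :
    vecTransvection v φ h * vecTransvection v' φ h'
      = vecTransvection (v + v') φ (by rw [dotProduct_add, h, h', add_zero]) := by
  refine Subtype.ext ?_
  simp only [Matrix.SpecialLinearGroup.coe_mul, coe_vecTransvection, mul_add, mul_one, add_mul,
    one_mul, vecMulVec_mul_vecMulVec, h', add_vecMulVec]
  simp [add_assoc]

theorem vecTransvection_mul_right {v φ φ' : Fin n → F} (h : φ ⬝ᵥ v = 0) (h' : φ' ⬝ᵥ v = 0) :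
    vecTransvection v φ h * vecTransvection v φ' h'
      = vecTransvection v (φ + φ') (by rw [add_dotProduct, h, h', add_zero]) := by
  refine Subtype.ext ?_
  simp only [Matrix.SpecialLinearGroup.coe_mul, coe_vecTransvection, mul_add, mul_one, add_mul,
    one_mul, vecMulVec_mul_vecMulVec, h, vecMulVec_add]
  simp [add_assoc]

theorem vecTransvection_inv {v φ : Fin n → F} (h : φ ⬝ᵥ v = 0) :
    (vecTransvection v φ h)⁻¹ = vecTransvection (-v) φ (by rw [dotProduct_neg, h, neg_zero]) := by
  rw [inv_eq_iff_mul_eq_one, vecTransvection_mul_left]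
  simp_rw [add_neg_cancel]
  exact vecTransvection_zero_left φ

theorem mul_vecTransvection {v φ v' φ' : Fin n → F} (h : φ ⬝ᵥ v = 0) (h' : φ' ⬝ᵥ v' = 0)
    (g : SL(n, F)) (hv : g.1 *ᵥ v = v') (hφ : φ' ᵥ* g.1 = φ) :
    g * vecTransvection v φ h = vecTransvection v' φ' h' * g := by
  refine Subtype.ext ?_
  rw [Matrix.SpecialLinearGroup.coe_mul, Matrix.SpecialLinearGroup.coe_mul, coe_vecTransvection,
    coe_vecTransvection, mul_add, add_mul, mul_vecMulVec, vecMulVec_mul, hv, hφ, mul_one, one_mul]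

theorem isConj_vecTransvection {v φ v' φ' : Fin n → F} (h : φ ⬝ᵥ v = 0) (h' : φ' ⬝ᵥ v' = 0)
    (g : SL(n, F)) (hv : g.1 *ᵥ v = v') (hφ : φ' ᵥ* g.1 = φ) :
    IsConj (vecTransvection v φ h) (vecTransvection v' φ' h') :=
  isConj_iff.2 ⟨g, by rw [mul_vecTransvection h h' g hv hφ, mul_inv_cancel_right]⟩

theorem exists_dotProduct_eq_one_of_notMem {W : Submodule F (Fin n → F)} {v : Fin n → F}
    (hv : v ∉ W) : ∃ ψ : Fin n → F, ψ ⬝ᵥ v = 1 ∧ ∀ w ∈ W, ψ ⬝ᵥ w = 0 := by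
  obtain ⟨f, hf, hW⟩ := Submodule.exists_le_ker_of_notMem hv
  obtain ⟨ψ, rfl⟩ := (dotProductEquiv F (Fin n)).surjective f
  simp only [dotProductEquiv_apply_apply] at hf
  refine ⟨(ψ ⬝ᵥ v)⁻¹ • ψ, by rw [smul_dotProduct, smul_eq_mul, inv_mul_cancel₀ hf], fun w hw ↦ ?_⟩
  have : ψ ⬝ᵥ w = 0 := hW hw
  rw [smul_dotProduct, this, smul_zero]

theorem exists_ne_zero_two_dotProduct_eq_zero (hn : 3 ≤ n) (a b : Fin n → F) :
    ∃ x : Fin n → F, x ≠ 0 ∧ a ⬝ᵥ x = 0 ∧ b ⬝ᵥ x = 0 := by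
  have h : LinearMap.ker (Matrix.mulVecLin ![a, b]) ≠ ⊥ :=
    LinearMap.ker_ne_bot_of_finrank_lt (by simpa using Nat.lt_of_succ_le hn)
  obtain ⟨x, hx, hx0⟩ := Submodule.exists_mem_ne_zero_of_ne_bot h
  have hx' : (![a, b] : Matrix (Fin 2) (Fin n) F) *ᵥ x = 0 := hx
  exact ⟨x, hx0, congrFun hx' 0, congrFun hx' 1⟩

theorem isConj_vecTransvection_of_notMem_span {v v' φ : Fin n → F} (h : φ ⬝ᵥ v = 0)
    (h' : φ ⬝ᵥ v' = 0) (hv : v ≠ 0) (hv' : v' ∉ Submodule.span F {v}) :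
    IsConj (vecTransvection v φ h) (vecTransvection v' φ h') := by
  obtain ⟨ψ, hψ, hψ0⟩ := exists_dotProduct_eq_one_of_notMem
    (W := Submodule.span F {v' - v}) (v := v) (by
      rw [Submodule.mem_span_singleton]
      rintro ⟨c, hc⟩
      have hc0 : c ≠ 0 := by rintro rfl; exact hv (by rw [← hc, zero_smul])
      refine hv' (Submodule.mem_span_singleton.2 ⟨c⁻¹ * (1 + c), ?_⟩)
      rw [mul_smul, inv_smul_eq_iff₀ hc0, add_smul, one_smul]
      nth_rw 1 [← hc]
      rw [smul_sub, sub_add_cancel])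
  have h0 := hψ0 _ (Submodule.mem_span_singleton_self _)
  refine isConj_vecTransvection h h' (vecTransvection (v' - v) ψ h0) ?_ ?_
  · rw [vecTransvection_mulVec, hψ, one_smul, add_sub_cancel]
  · rw [vecMul_vecTransvection, dotProduct_sub, h, h', sub_zero, zero_smul, add_zero]

theorem isConj_vecTransvection_left (hn : 3 ≤ n) {v v' φ : Fin n → F} (h : φ ⬝ᵥ v = 0)
    (h' : φ ⬝ᵥ v' = 0) (hv : v ≠ 0) (hv' : v' ≠ 0) :
    IsConj (vecTransvection v φ h) (vecTransvection v' φ h') := by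
  by_cases hvv : v' ∈ Submodule.span F {v}
  · obtain ⟨ψ, hψ, -⟩ := exists_dotProduct_eq_one_of_notMem (W := ⊥) (v := v) (by simpa using hv)
    obtain ⟨x, hx0, hxφ, hxψ⟩ := exists_ne_zero_two_dotProduct_eq_zero hn φ ψ
    have hx : ∀ c : F, c • v ≠ x := fun c hc ↦ by
      have h1 : ψ ⬝ᵥ (c • v) = c := by rw [dotProduct_smul, hψ, smul_eq_mul, mul_one]
      rw [hc, hxψ] at h1
      exact hx0 (by rw [← hc, ← h1, zero_smul])
    refine (isConj_vecTransvection_of_notMem_span h hxφ hv ?_).trans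
      (isConj_vecTransvection_of_notMem_span hxφ h' hx0 ?_)
    · rw [Submodule.mem_span_singleton]
      exact fun ⟨c, hc⟩ ↦ hx c hc
    · obtain ⟨c, rfl⟩ := Submodule.mem_span_singleton.1 hvv
      rw [Submodule.mem_span_singleton]
      rintro ⟨d, hd⟩
      have hd0 : d ≠ 0 := by rintro rfl; exact hv' (by rw [← hd, zero_smul])
      exact hx (d⁻¹ * c) (by rw [mul_smul, inv_smul_eq_iff₀ hd0, hd])
  · exact isConj_vecTransvection_of_notMem_span h h' hv hvv

theorem Matrix.SpecialLinearGroup.isConj_transpose {a b : SL(n, F)} (h : IsConj a b) :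
    IsConj a.transpose b.transpose := by
  obtain ⟨c, hc⟩ := isConj_iff.1 h
  refine IsConj.symm (isConj_iff.2 ⟨c.transpose, ?_⟩)
  rw [mul_inv_eq_iff_eq_mul] at hc ⊢
  refine Subtype.ext ?_
  rw [Matrix.SpecialLinearGroup.coe_mul, Matrix.SpecialLinearGroup.coe_mul,
    Matrix.SpecialLinearGroup.coe_transpose, Matrix.SpecialLinearGroup.coe_transpose,
    Matrix.SpecialLinearGroup.coe_transpose, ← transpose_mul, ← transpose_mul,
    ← Matrix.SpecialLinearGroup.coe_mul, ← Matrix.SpecialLinearGroup.coe_mul, hc]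

theorem transpose_vecTransvection {v φ : Fin n → F} (h : φ ⬝ᵥ v = 0) :
    (vecTransvection v φ h).transpose = vecTransvection φ v (by rwa [dotProduct_comm]) := by
  refine Subtype.ext ?_
  simp [Matrix.SpecialLinearGroup.coe_transpose, coe_vecTransvection, transpose_vecMulVec]

theorem isConj_vecTransvection_right (hn : 3 ≤ n) {v φ φ' : Fin n → F} (h : φ ⬝ᵥ v = 0)
    (h' : φ' ⬝ᵥ v = 0) (hφ : φ ≠ 0) (hφ' : φ' ≠ 0) :
    IsConj (vecTransvection v φ h) (vecTransvection v φ' h') := by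
  have := Matrix.SpecialLinearGroup.isConj_transpose (isConj_vecTransvection_left hn
    (v := φ) (v' := φ') (φ := v) (by rwa [dotProduct_comm]) (by rwa [dotProduct_comm]) hφ hφ')
  rwa [transpose_vecTransvection, transpose_vecTransvection] at this

theorem isConj_vecTransvection_of_ne_zero (hn : 3 ≤ n) {v φ v' φ' : Fin n → F} (h : φ ⬝ᵥ v = 0)
    (h' : φ' ⬝ᵥ v' = 0) (hv : v ≠ 0) (hφ : φ ≠ 0) (hv' : v' ≠ 0) (hφ' : φ' ≠ 0) :
    IsConj (vecTransvection v φ h) (vecTransvection v' φ' h') := by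
  obtain ⟨w, hw, hwφ, hwφ'⟩ := exists_ne_zero_two_dotProduct_eq_zero hn φ φ'
  exact (isConj_vecTransvection_left hn h hwφ hv hw).trans
    ((isConj_vecTransvection_right hn hwφ hwφ' hφ hφ').trans
      (isConj_vecTransvection_left hn hwφ' h' hw hv'))

theorem exists_eq_vecTransvection {g : SL(n, F)} {ψ : Fin n → F} (hψ : ψ ≠ 0)
    (hg : ∀ x, ψ ⬝ᵥ x = 0 → g.1 *ᵥ x = x) : ∃ v h, g = vecTransvection v ψ h := by
  obtain ⟨e, he, -⟩ := exists_dotProduct_eq_one_of_notMem (W := ⊥) (v := ψ) (by simpa using hψ)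
  rw [dotProduct_comm] at he
  have key : g.1 = 1 + vecMulVec (g.1 *ᵥ e - e) ψ := by
    refine ext_iff_mulVec.2 fun x ↦ ?_
    have h1 := hg (x - (ψ ⬝ᵥ x) • e) (by rw [dotProduct_sub, dotProduct_smul, he]; simp)
    rw [mulVec_sub, mulVec_smul] at h1
    rw [add_mulVec, one_mulVec, vecMulVec_mulVec, op_smul_eq_smul, smul_sub]
    linear_combination (exp := 1) h1
  refine ⟨g.1 *ᵥ e - e, ?_, Subtype.ext key⟩
  have hdet := g.2
  rw [key, vecMulVec_eq Unit, det_one_add_replicateCol_mul_replicateRow] at hdet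
  simpa using hdet

theorem exists_vecTransvection_mulVec_eq {W : Submodule F (Fin n → F)} {a b : Fin n → F}
    (ha : a ∉ W) (hb : b ∉ W ⊔ Submodule.span F {a}) :
    ∃ v φ h, (vecTransvection v φ h).1 *ᵥ a = b ∧ ∀ w ∈ W, (vecTransvection v φ h).1 *ᵥ w = w := by
  obtain ⟨ψ, hψa, hψ⟩ := exists_dotProduct_eq_one_of_notMem
    (W := W ⊔ Submodule.span F {b - a}) (v := a) (by
      rw [Submodule.mem_sup]
      rintro ⟨w, hw, y, hy, hwy⟩
      obtain ⟨c, rfl⟩ := Submodule.mem_span_singleton.1 hy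
      rcases eq_or_ne c 0 with rfl | hc
      · exact ha (by rwa [← hwy, zero_smul, add_zero])
      · refine hb (Submodule.mem_sup.2 ⟨-c⁻¹ • w, W.smul_mem _ hw, (c⁻¹ * (1 + c)) • a,
          Submodule.mem_span_singleton.2 ⟨_, rfl⟩, ?_⟩)
        have h1 : (1 + c) • a = w + c • b := by
          rw [add_smul, one_smul]
          nth_rw 1 [← hwy]
          rw [smul_sub]
          abel
        rw [mul_smul, h1, smul_add, inv_smul_smul₀ hc, neg_smul, neg_add_cancel_left])
  have h0 := hψ _ (Submodule.mem_sup_right (Submodule.mem_span_singleton_self _))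
  refine ⟨b - a, ψ, h0, ?_, fun w hw ↦ ?_⟩
  · rw [vecTransvection_mulVec, hψa, one_smul, add_sub_cancel]
  · rw [vecTransvection_mulVec, hψ w (Submodule.mem_sup_left hw), zero_smul, add_zero]

theorem exists_mem_sq_mulVec_eq {T : Set SL(n, F)} (h1 : 1 ∈ T)
    (hT : ∀ v φ h, vecTransvection v φ h ∈ T) {W : Submodule F (Fin n → F)}
    (hW : Module.finrank F W + 1 < n) {a b : Fin n → F} (ha : a ∉ W) (hb : b ∉ W) :
    ∃ t ∈ T ^ 2, t.1 *ᵥ a = b ∧ ∀ w ∈ W, t.1 *ᵥ w = w := by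
  by_cases hab : b ∈ W ⊔ Submodule.span F {a}
  · obtain ⟨y, hy⟩ : ∃ y, y ∉ W ⊔ Submodule.span F {a} := by
      by_contra! h
      have h2 := Submodule.finrank_sup_span_singleton ha
      rw [(Submodule.eq_top_iff' (p := W ⊔ Submodule.span F {a})).2 h, finrank_top,
        Module.finrank_fin_fun] at h2
      omega
    obtain ⟨v, φ, h, ht, htW⟩ := exists_vecTransvection_mulVec_eq ha hy
    have hb' : b ∉ W ⊔ Submodule.span F {y} := by
      rw [Submodule.mem_sup]
      rintro ⟨w, hw, z, hz, hwz⟩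
      obtain ⟨c, rfl⟩ := Submodule.mem_span_singleton.1 hz
      rcases eq_or_ne c 0 with rfl | hc
      · exact hb (by rwa [← hwz, zero_smul, add_zero])
      · refine hy ?_
        have : y = c⁻¹ • (b - w) := by
          rw [← hwz, add_sub_cancel_left, inv_smul_smul₀ hc]
        rw [this]
        exact Submodule.smul_mem _ _ (Submodule.sub_mem _ hab (Submodule.mem_sup_left hw))
    obtain ⟨v', φ', h', ht', htW'⟩ :=
      exists_vecTransvection_mulVec_eq (fun hyW ↦ hy (Submodule.mem_sup_left hyW)) hb'
    refine ⟨_, by rw [pow_two]; exact Set.mul_mem_mul (hT v' φ' h') (hT v φ h), ?_, fun w hw ↦ ?_⟩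
    · rw [Matrix.SpecialLinearGroup.coe_mul, ← mulVec_mulVec, ht, ht']
    · rw [Matrix.SpecialLinearGroup.coe_mul, ← mulVec_mulVec, htW w hw, htW' w hw]
  · obtain ⟨v, φ, h, ht, htW⟩ := exists_vecTransvection_mulVec_eq ha hab
    refine ⟨vecTransvection v φ h, ?_, ht, htW⟩
    rw [pow_two, ← mul_one (vecTransvection v φ h)]
    exact Set.mul_mem_mul (hT _ _ _) h1

theorem mem_pow_of_forall_mulVec_eq {T : Set SL(n, F)} (h1 : 1 ∈ T)
    (hT : ∀ v φ h, vecTransvection v φ h ∈ T) (d : ℕ) (W : Submodule F (Fin n → F))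
    (hW : Module.finrank F W + d + 1 = n) (g : SL(n, F)) (hg : ∀ w ∈ W, g.1 *ᵥ w = w) :
    g ∈ T ^ (2 * d + 1) := by
  induction d generalizing W g with
  | zero =>
    obtain ⟨e, he⟩ : ∃ e, e ∉ W := by
      by_contra! h
      rw [(Submodule.eq_top_iff' (p := W)).2 h, finrank_top, Module.finrank_fin_fun] at hW
      omega
    obtain ⟨ψ, hψe, hψ⟩ := exists_dotProduct_eq_one_of_notMem he
    have hψ0 : ψ ≠ 0 := by rintro rfl; simp at hψe
    have htop : W ⊔ Submodule.span F {e} = ⊤ := by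
      apply Submodule.eq_top_of_finrank_eq
      rw [Submodule.finrank_sup_span_singleton he, Module.finrank_fin_fun]
      exact hW
    obtain ⟨v, h, rfl⟩ := exists_eq_vecTransvection (g := g) hψ0 fun x hx ↦ by
      obtain ⟨w, hw, z, hz, rfl⟩ := Submodule.mem_sup.1 (htop ▸ Submodule.mem_top : x ∈ _)
      obtain ⟨c, rfl⟩ := Submodule.mem_span_singleton.1 hz
      rw [dotProduct_add, hψ w hw, dotProduct_smul, hψe, zero_add, smul_eq_mul, mul_one] at hx
      rw [hx, zero_smul, add_zero, hg w hw]
    simpa using hT v ψ h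
  | succ d ih =>
    obtain ⟨x, hx⟩ : ∃ x, x ∉ W := by
      by_contra! h
      rw [(Submodule.eq_top_iff' (p := W)).2 h, finrank_top, Module.finrank_fin_fun] at hW
      omega
    have hinv (y) : (g⁻¹).1 *ᵥ (g.1 *ᵥ y) = y := by
      rw [mulVec_mulVec, ← Matrix.SpecialLinearGroup.coe_mul, inv_mul_cancel,
        Matrix.SpecialLinearGroup.coe_one, one_mulVec]
    have hgx : g.1 *ᵥ x ∉ W := fun h ↦ hx <| by
      have h2 := hg _ h
      have h3 := congrArg ((g⁻¹).1 *ᵥ ·) h2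
      simp only [hinv] at h3
      rwa [h3] at h
    obtain ⟨t, ht, htx, htW⟩ := exists_mem_sq_mulVec_eq h1 hT (by omega) hx hgx
    have hinv' (y z) (h : t.1 *ᵥ y = z) : (t⁻¹).1 *ᵥ z = y := by
      rw [← h, mulVec_mulVec, ← Matrix.SpecialLinearGroup.coe_mul, inv_mul_cancel,
        Matrix.SpecialLinearGroup.coe_one, one_mulVec]
    have key := ih (W ⊔ Submodule.span F {x}) (by
      rw [Submodule.finrank_sup_span_singleton hx]; omega) (t⁻¹ * g) fun y hy ↦ by
        obtain ⟨w, hw, z, hz, rfl⟩ := Submodule.mem_sup.1 hy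
        obtain ⟨c, rfl⟩ := Submodule.mem_span_singleton.1 hz
        rw [Matrix.SpecialLinearGroup.coe_mul, ← mulVec_mulVec, mulVec_add, mulVec_smul, hg w hw,
          mulVec_add, mulVec_smul, hinv' _ _ (htW w hw), hinv' _ _ htx]
    have := Set.mul_mem_mul ht key
    rw [mul_inv_cancel_left, ← pow_add] at this
    convert this using 2
    ring

theorem mem_pow_of_forall_vecTransvection_mem (hn : 1 ≤ n) {T : Set SL(n, F)} (h1 : 1 ∈ T)
    (hT : ∀ v φ h, vecTransvection v φ h ∈ T) (g : SL(n, F)) : g ∈ T ^ (2 * n - 1) := by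
  have := mem_pow_of_forall_mulVec_eq h1 hT (n - 1) ⊥ (by rw [finrank_bot]; omega) g
    (by simp)
  rwa [show 2 * (n - 1) + 1 = 2 * n - 1 by omega] at this

theorem closure_vecTransvection (hn : 1 ≤ n) :
    Subgroup.closure {g : SL(n, F) | ∃ v φ h, g = vecTransvection v φ h} = ⊤ := by
  refine Subgroup.eq_top_iff' _ |>.2 fun g ↦ ?_
  have := mem_pow_of_forall_vecTransvection_mem hn (T := (Subgroup.closure
    {g : SL(n, F) | ∃ v φ h, g = vecTransvection v φ h} : Set SL(n, F))) (one_mem _)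
    (fun v φ h ↦ Subgroup.subset_closure ⟨v, φ, h, rfl⟩) g
  exact Subgroup.pow_subset subset_rfl this

/-- A normal set containing a non-central element produces all transvections quickly. -/
theorem vecTransvection_mem_pow (hn : 3 ≤ n) {U : Set SL(n, F)} (h1 : 1 ∈ U) (hinv : U⁻¹ = U)
    (hconj : ∀ g, ∀ u ∈ U, g * u * g⁻¹ ∈ U) {a : SL(n, F)} (ha : a ∈ U)
    (hac : a ∉ Subgroup.center SL(n, F)) (v φ : Fin n → F) (h : φ ⬝ᵥ v = 0) :
    vecTransvection v φ h ∈ U ^ 4 := by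
  have hUinv {x} (hx : x ∈ U) : x⁻¹ ∈ U := by rw [← hinv]; simpa using hx
  have hpow (k : ℕ) : ∀ g, ∀ u ∈ U ^ k, g * u * g⁻¹ ∈ U ^ k := by
    induction k with
    | zero => intro g u hu; simp_all
    | succ k ih =>
      intro g u hu
      rw [pow_succ] at hu ⊢
      obtain ⟨x, hx, y, hy, rfl⟩ := hu
      exact ⟨_, ih g x hx, _, hconj g y hy, by group⟩
  obtain ⟨v₁, φ₁, h₁, hne⟩ : ∃ v φ h, a * vecTransvection v φ h ≠ vecTransvection v φ h * a := by
    by_contra! hcomm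
    refine hac (Subgroup.mem_center_iff.2 fun g ↦ ?_)
    have : Subgroup.closure {g : SL(n, F) | ∃ v φ h, g = vecTransvection v φ h}
        ≤ Subgroup.centralizer {a} := by
      rw [Subgroup.closure_le]
      rintro _ ⟨v, φ, h, rfl⟩
      exact Subgroup.mem_centralizer_singleton_iff.2 (hcomm v φ h).symm
    rw [closure_vecTransvection (by omega)] at this
    exact Subgroup.mem_centralizer_singleton_iff.1 (this (Subgroup.mem_top g))
  set x := vecTransvection v₁ φ₁ h₁ with hx
  set c := a * x * a⁻¹ * x⁻¹ with hc
  have hcU : c ∈ U ^ 2 := by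
    rw [pow_two, hc, mul_assoc, mul_assoc, ← mul_assoc x]
    exact Set.mul_mem_mul ha (hconj x _ (hUinv ha))
  have hcU' : c⁻¹ ∈ U ^ 2 := by
    rw [← hinv, inv_pow]
    simpa using hcU
  have hc1 : c ≠ 1 := fun h ↦ hne <| by
    rw [hc, mul_inv_eq_one, mul_inv_eq_iff_eq_mul] at h
    exact h
  obtain ⟨θ, hθ0, hθv, hθav⟩ := exists_ne_zero_two_dotProduct_eq_zero hn v₁ (a.1 *ᵥ v₁)
  rw [dotProduct_comm] at hθv hθav
  have hθx : θ ᵥ* x.1 = θ := by rw [hx, vecMul_vecTransvection, hθv, zero_smul, add_zero]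
  have hθaxa : θ ᵥ* (a * x * a⁻¹).1 = θ := by
    have h2 : (φ₁ ᵥ* (a⁻¹).1) ᵥ* a.1 = φ₁ := by
      rw [vecMul_vecMul, ← Matrix.SpecialLinearGroup.coe_mul, inv_mul_cancel,
        Matrix.SpecialLinearGroup.coe_one, vecMul_one]
    have h3 : a * x = vecTransvection (a.1 *ᵥ v₁) (φ₁ ᵥ* (a⁻¹).1)
        (by rw [dotProduct_mulVec, h2, h₁]) * a := mul_vecTransvection _ _ _ rfl h2
    rw [h3, mul_inv_cancel_right, vecMul_vecTransvection, hθav, zero_smul, add_zero]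
  have hθc : θ ᵥ* c.1 = θ := by
    rw [hc, Matrix.SpecialLinearGroup.coe_mul, ← vecMul_vecMul, hθaxa, hx, vecTransvection_inv,
      vecMul_vecTransvection, dotProduct_neg, hθv, neg_zero, zero_smul, add_zero]
  obtain ⟨z, hz, hz0, hzU⟩ : ∃ z, ∃ hz : θ ⬝ᵥ z = 0, z ≠ 0 ∧ vecTransvection z θ hz ∈ U ^ 4 := by
    by_cases hfix : ∀ u, θ ⬝ᵥ u = 0 → c.1 *ᵥ u = u
    · obtain ⟨z, hz, hcz⟩ := exists_eq_vecTransvection hθ0 hfix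
      refine ⟨z, hz, ?_, ?_⟩
      · rintro rfl
        exact hc1 (hcz.trans (vecTransvection_zero_left θ))
      · rw [← hcz]
        exact Set.pow_subset_pow_right h1 (by norm_num : 2 ≤ 4) hcU
    · push Not at hfix
      obtain ⟨u, hu, hcu⟩ := hfix
      have hcu0 : θ ⬝ᵥ (c.1 *ᵥ u) = 0 := by rw [dotProduct_mulVec, hθc, hu]
      have h3 := mul_vecTransvection hu hcu0 c rfl hθc
      refine ⟨c.1 *ᵥ u + -u, by rw [dotProduct_add, hcu0, dotProduct_neg, hu]; simp,
        by rwa [← sub_eq_add_neg, sub_ne_zero], ?_⟩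
      rw [← vecTransvection_mul_left hcu0 (by rw [dotProduct_neg, hu, neg_zero]),
        ← vecTransvection_inv hu, ← mul_inv_eq_iff_eq_mul.2 h3, mul_assoc, mul_assoc,
        ← mul_assoc (vecTransvection u θ hu), show 4 = 2 + 2 from rfl, pow_add]
      exact Set.mul_mem_mul hcU (hpow 2 _ _ hcU')
  have h14 : (1 : SL(n, F)) ∈ U ^ 4 := Set.one_mem_pow h1
  rcases eq_or_ne v 0 with rfl | hv
  · rwa [vecTransvection_zero_left]
  rcases eq_or_ne φ 0 with rfl | hφ
  · rwa [vecTransvection_zero_right]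
  obtain ⟨g, hg⟩ := isConj_iff.1 (isConj_vecTransvection_of_ne_zero hn hz h hz0 hθ0 hv hφ)
  rw [← hg]
  exact hpow 4 g _ hzU

/-- For `n + 1 ≥ 3`, the group `SL(n + 1, q)` is `(q ^ n - 1)`-quasirandom. -/
theorem isQuasirandom_SL [Fintype F] (hn : 2 ≤ n) :
    IsQuasirandom SL(n + 1, F) ((Fintype.card F : ℝ) ^ n - 1) := by
  classical
  intro V _ _ _ ρ hρ
  have h0 (φ : Fin n → F) : (Fin.cons 0 φ : Fin (n + 1) → F) ⬝ᵥ Pi.single 0 1 = 0 := by simp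
  let f : Multiplicative (Fin n → F) →* SL(n + 1, F) := MonoidHom.mk'
    (fun φ ↦ vecTransvection (Pi.single 0 1) (Fin.cons 0 φ.toAdd) (h0 _)) fun φ φ' ↦ by
      rw [vecTransvection_mul_right]
      congr 1
      ext i
      refine Fin.cases ?_ (fun i ↦ ?_) i <;> simp
  have hs : (Pi.single 0 1 : Fin (n + 1) → F) ≠ 0 := by simp
  have hc {φ : Fin n → F} (hφ : φ ≠ 0) : (Fin.cons 0 φ : Fin (n + 1) → F) ≠ 0 := fun h ↦
    hφ (funext fun i ↦ by simpa using congrFun h i.succ)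
  obtain ⟨e₀, he₀⟩ : ∃ e : Fin n → F, e ≠ 0 :=
    ⟨Pi.single ⟨0, by omega⟩ 1, by simp⟩
  have hfconj {e : Fin n → F} (he : e ≠ 0) {v φ : Fin (n + 1) → F} (h : φ ⬝ᵥ v = 0) (hv : v ≠ 0)
      (hφ : φ ≠ 0) : IsConj (f (.ofAdd e)) (vecTransvection v φ h) :=
    isConj_vecTransvection_of_ne_zero (by omega) (h0 _) _ hs (hc he) hv hφ
  have key := card_sub_one_le_finrank_of_trace_eq (ρ.comp f)
    (LinearMap.trace ℂ V (ρ (f (.ofAdd e₀))))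
    (fun e he ↦ ρ.trace_eq_of_isConj (hfconj he (h0 e₀) hs (hc he₀))) (by
      by_contra! h
      obtain ⟨g, hg⟩ := hρ
      have hker : Subgroup.closure {g : SL(n + 1, F) | ∃ v φ h, g = vecTransvection v φ h}
          ≤ MonoidHom.ker ρ := by
        rw [Subgroup.closure_le]
        rintro _ ⟨v, φ, hv, rfl⟩
        by_cases hv0 : v = 0
        · subst hv0
          rw [vecTransvection_zero_left]
          exact one_mem _
        by_cases hφ0 : φ = 0
        · subst hφ0
          rw [vecTransvection_zero_right]
          exact one_mem _
        obtain ⟨c, hc⟩ := isConj_iff.1 (hfconj he₀ hv hv0 hφ0)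
        rw [← hc]
        exact (MonoidHom.normal_ker ρ).conj_mem _ (h (.ofAdd e₀)) c
      rw [closure_vecTransvection (by omega)] at hker
      exact hg (hker (Subgroup.mem_top g)))
  have h1 : (Fintype.card F) ^ n ≤ Module.finrank ℂ V + 1 := by
    simpa using key
  have h2 : (Fintype.card F : ℝ) ^ n ≤ Module.finrank ℂ V + 1 := by exact_mod_cast h1
  linarith

end Transvections

section Growth

open Finset

variable {G : Type} [Group G] [Fintype G] [DecidableEq G]

/-- If `S` has small tripling and contains a quasirandom subgroup `H`, then all conjugates of `H`
are contained in `S ^ 6`. -/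
theorem IsQuasirandom.conj_mem_pow_six {H : Subgroup G} {k K : ℝ} (hH : IsQuasirandom H k)
    {S : Finset G} (hHS : (H : Set G) ⊆ S) (hsym : S⁻¹ = S)
    (hgen : Subgroup.closure (S : Set G) = ⊤) (hS : (#(S ^ 3) : ℝ) ≤ K * #S)
    (hK : K ^ 21 < k) (g : G) {h : G} (hh : h ∈ H) : g * h * g⁻¹ ∈ S ^ 6 := by
  classical
  have h1S : 1 ∈ S := mod_cast hHS H.one_mem
  have hSpos : (0 : ℝ) < #S := by exact_mod_cast Finset.card_pos.2 ⟨1, h1S⟩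
  have hK0 : 0 ≤ K := nonneg_of_mul_nonneg_left ((Nat.cast_nonneg _).trans hS) hSpos
  have hSinv {x} (hx : x ∈ S) : x⁻¹ ∈ S := by rw [← hsym]; exact Finset.inv_mem_inv hx
  let A (g : G) : Finset H := univ.filter fun h ↦ g * h * g⁻¹ ∈ S ^ 2
  let P (g : G) : Prop := (Fintype.card H : ℝ) ≤ K ^ 7 * #(A g)
  have hpow (g : G) (hg : P g) (h : H) : g * h * g⁻¹ ∈ S ^ 6 := by
    have hpos : (0 : ℝ) < #(A g) := by
      by_contra! h0
      have h0 : (#(A g) : ℝ) = 0 := le_antisymm h0 (Nat.cast_nonneg _)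
      have hP : (Fintype.card H : ℝ) ≤ K ^ 7 * #(A g) := hg
      rw [h0, mul_zero] at hP
      exact absurd hP (not_le.2 (by exact_mod_cast Fintype.card_pos))
    have hu : A g * A g * A g = univ := hH.mul_mul_eq_univ _ _ _ <| calc
      (Fintype.card H : ℝ) ^ 3 ≤ (K ^ 7 * #(A g)) ^ 3 := pow_le_pow_left₀ (Nat.cast_nonneg _) hg 3
      _ = K ^ 21 * (#(A g) * #(A g) * #(A g)) := by ring
      _ < k * (#(A g) * #(A g) * #(A g)) := mul_lt_mul_of_pos_right hK (by positivity)
    have hmem := Finset.mem_univ h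
    rw [← hu] at hmem
    obtain ⟨_, hab, c, hc, rfl⟩ := Finset.mem_mul.1 hmem
    obtain ⟨a, ha, b, hb, rfl⟩ := Finset.mem_mul.1 hab
    have := Finset.mul_mem_mul (Finset.mul_mem_mul (Finset.mem_filter.1 ha).2
      (Finset.mem_filter.1 hb).2) (Finset.mem_filter.1 hc).2
    rw [← pow_add, ← pow_add] at this
    convert this using 1
    simp [mul_assoc]
  have hstep (g s : G) (hs : s ∈ S) (hg : P g) : P (s * g) := by
    have hcard : #(S ×ˢ (univ : Finset H)) ≤ #(A (s * g)) * #(S ^ 9) := by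
      refine Finset.card_le_mul_card_image_of_maps_to
        (f := fun p ↦ p.1 * (s * g * p.2 * (s * g)⁻¹)) (fun p hp ↦ ?_) _ fun y _ ↦ ?_
      · have h1 := Finset.mul_mem_mul (Finset.mul_mem_mul (Finset.mul_mem_mul
          (Finset.mem_product.1 hp).1 hs) (hpow g hg p.2)) (hSinv hs)
        rw [← pow_two, ← pow_add, ← pow_succ] at h1
        convert h1 using 1
        group
      · obtain hemp | ⟨p₀, hp₀⟩ :=
          ((S ×ˢ (univ : Finset H)).filter
            fun p ↦ p.1 * (s * g * p.2 * (s * g)⁻¹) = y).eq_empty_or_nonempty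
        · rw [hemp]; simp
        rw [Finset.mem_filter, Finset.mem_product] at hp₀
        refine Finset.card_le_card_of_injOn (fun p ↦ p.2 * p₀.2⁻¹) (fun p hp ↦ ?_) ?_
        · rw [Finset.mem_coe, Finset.mem_filter, Finset.mem_product] at hp
          have h1 : s * g * (p.2 * p₀.2⁻¹ : H) * (s * g)⁻¹ = p.1⁻¹ * p₀.1 := by
            have h2 := eq_inv_mul_of_mul_eq (hp.2.trans hp₀.2.symm)
            calc _ = s * g * p.2 * (s * g)⁻¹ * (s * g * p₀.2 * (s * g)⁻¹)⁻¹ := by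
                  push_cast
                  group
              _ = _ := by
                  rw [h2]
                  group
          rw [Finset.mem_coe, Finset.mem_filter, h1, pow_two]
          exact ⟨Finset.mem_univ _, Finset.mul_mem_mul (hSinv hp.1.1) hp₀.1.1⟩
        · intro p hp p' hp' hpp
          rw [Finset.mem_coe, Finset.mem_filter] at hp hp'
          have h2 : p.2 = p'.2 := mul_right_cancel hpp
          have h3 := hp.2.trans hp'.2.symm
          rw [h2] at h3
          exact Prod.ext (mul_right_cancel h3) h2
    rw [Finset.card_product, Finset.card_univ] at hcard
    have h9 : (#(S ^ 9) : ℝ) ≤ K ^ 7 * #S :=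
      Finset.small_pow_of_small_tripling (by norm_num) hS hsym
    have hcard' : (#S : ℝ) * Fintype.card H ≤ #(A (s * g)) * #(S ^ 9) := by exact_mod_cast hcard
    have : (#S : ℝ) * Fintype.card H ≤ #S * (K ^ 7 * #(A (s * g))) := calc
      _ ≤ _ := hcard'
      _ ≤ #(A (s * g)) * (K ^ 7 * #S) := mul_le_mul_of_nonneg_left h9 (Nat.cast_nonneg _)
      _ = _ := by ring
    exact le_of_mul_le_mul_left this hSpos
  have hP1 : P 1 := by
    have hA : A 1 = univ := by
      ext h
      have h1 := Finset.mul_mem_mul (Finset.mem_coe.1 (hHS h.2)) h1S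
      simpa [A, pow_two] using h1
    have h3 : (#S : ℝ) ≤ #(S ^ 3) := by
      exact_mod_cast Finset.card_le_card (Finset.subset_pow h1S (by norm_num))
    have hK1 : 1 ≤ K := by
      by_contra! h
      nlinarith
    simp only [P, hA, Finset.card_univ]
    exact le_mul_of_one_le_left (Nat.cast_nonneg _) (one_le_pow₀ hK1)
  have hall : ∀ g, P g := fun g ↦ by
    have hg : g ∈ Subgroup.closure (S : Set G) := by rw [hgen]; trivial
    induction hg using Subgroup.closure_induction_left with
    | one => exact hP1
    | mul_left s hs g _ ih => exact hstep g s hs ih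
    | inv_mul_cancel s hs g _ ih => exact hstep g _ (hSinv hs) ih
  exact hpow g (hall g) ⟨h, hh⟩

/-- A Plünnecke-type inequality for normal sets. -/
theorem card_le_pow_mul_card_of_pow_eq_univ {S U : Finset G} (hS : S.Nonempty)
    (hU : ∀ g, ∀ u ∈ U, g * u * g⁻¹ ∈ U) {c : ℝ} (hc : (#(U * S) : ℝ) ≤ c * #S) {m : ℕ}
    (hm : U ^ m = univ) : (Fintype.card G : ℝ) ≤ c ^ m * #S := by
  have hcomm (X : Finset G) : X * U = U * X := by
    ext y
    simp only [Finset.mem_mul]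
    constructor
    · rintro ⟨x, hx, u, hu, rfl⟩
      exact ⟨x * u * x⁻¹, hU x u hu, x, hx, by group⟩
    · rintro ⟨u, hu, x, hx, rfl⟩
      exact ⟨x, hx, x⁻¹ * u * x, by simpa using hU x⁻¹ u hu, by group⟩
  obtain ⟨X, hX, hmin⟩ := Finset.exists_min_image (S.powerset.filter Finset.Nonempty)
    (fun X ↦ (#(X * U) : ℝ) / #X) ⟨S, by simp [hS]⟩
  simp only [Finset.mem_filter, Finset.mem_powerset, and_imp] at hX hmin
  have hXpos : (0 : ℝ) < #X := by exact_mod_cast hX.2.card_pos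
  have hSpos : (0 : ℝ) < #S := by exact_mod_cast hS.card_pos
  have hXc : (#(X * U) : ℝ) ≤ c * #X := by
    rw [← div_le_iff₀ hXpos]
    refine (hmin S subset_rfl hS).trans ?_
    rwa [div_le_iff₀ hSpos, hcomm]
  have hc0 : 0 ≤ c := nonneg_of_mul_nonneg_left ((Nat.cast_nonneg _).trans hc) hSpos
  have hA : ∀ A' ⊆ X, #(X * U) * #A' ≤ #(A' * U) * #X := fun A' hA' ↦ by
    obtain rfl | hne := A'.eq_empty_or_nonempty
    · simp
    have h1 := hmin A' (hA'.trans hX.1) hne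
    rw [div_le_div_iff₀ hXpos (by exact_mod_cast hne.card_pos)] at h1
    exact_mod_cast h1
  have key (j : ℕ) : (#(U ^ j * X) : ℝ) ≤ c ^ j * #X := by
    induction j with
    | zero => simp
    | succ j ih =>
      have h1 := Finset.pluennecke_petridis_inequality_mul (U ^ j) hA
      have h2 : U ^ j * X * U = U ^ (j + 1) * X := by
        rw [mul_assoc, hcomm, ← mul_assoc, pow_succ]
      rw [h2] at h1
      have h3 : (#(U ^ (j + 1) * X) : ℝ) * #X ≤ #(X * U) * #(U ^ j * X) := by exact_mod_cast h1
      have h4 : (#(U ^ (j + 1) * X) : ℝ) * #X ≤ c ^ (j + 1) * #X * #X := calc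
        _ ≤ _ := h3
        _ ≤ (c * #X) * (c ^ j * #X) :=
          mul_le_mul hXc ih (Nat.cast_nonneg _) (by positivity)
        _ = _ := by ring
      exact le_of_mul_le_mul_right h4 hXpos
  have hfin := key m
  rw [hm] at hfin
  have huniv : (univ : Finset G) * X = univ := by
    obtain ⟨x, hx⟩ := hX.2
    exact Finset.eq_univ_of_forall fun g ↦
      Finset.mem_mul.2 ⟨g * x⁻¹, Finset.mem_univ _, x, hx, by group⟩
  rw [huniv, Finset.card_univ] at hfin
  refine hfin.trans (mul_le_mul_of_nonneg_left ?_ (by positivity))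
  exact_mod_cast Finset.card_le_card hX.1

end Growth

section BabyProduct

variable {F : Type} [Field F]

theorem exists_mem_notMem_center_of_mulEquiv_SL2 {G : Type} [Group G] {H : Subgroup G}
    (e : H ≃* SL(2, F)) : ∃ a ∈ H, a ∉ Subgroup.center G := by
  by_contra! h
  have hcomm (x y : SL(2, F)) : x * y = y * x := by
    have := (Subgroup.mem_center_iff.1 (h _ (e.symm y).2) (e.symm x))
    apply e.symm.injective
    rw [map_mul, map_mul]
    exact Subtype.ext this
  have h1 := congrArg (fun g : SL(2, F) ↦ (g : Matrix (Fin 2) (Fin 2) F) 0 0)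
    (hcomm ⟨!![1, 1; 0, 1], by simp⟩ ⟨!![1, 0; 1, 1], by simp⟩)
  change (!![1, 1; 0, 1] * !![1, 0; 1, 1] : Matrix (Fin 2) (Fin 2) F) 0 0
    = (!![1, 0; 1, 1] * !![1, 1; 0, 1] : Matrix (Fin 2) (Fin 2) F) 0 0 at h1
  simp at h1

theorem Real.rpow_inv_thousand_pow_lt {q : ℝ} (hq : 4 ≤ q) :
    (q ^ ((1 : ℝ) / 1000)) ^ 21 < (q - 1) / 2 := by
  have h := rpow_one_add_le_one_add_mul_self (s := q - 1) (p := 21 / 1000) (by linarith)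
    (by norm_num) (by norm_num)
  rw [← Real.rpow_natCast, ← Real.rpow_mul (by linarith)]
  rw [add_sub_cancel] at h
  norm_num at h ⊢
  linarith

theorem Real.rpow_inv_thousand_pow_lt_pow_sub_one {q : ℝ} (hq : 4 ≤ q) {n : ℕ} (hn : 2 ≤ n) :
    (q ^ ((1 : ℝ) / 1000)) ^ (15 * (4 * (2 * (n + 1) - 1))) < q ^ n - 1 := by
  have h16 : 4 ≤ q ^ n := hq.trans (le_self_pow₀ (by linarith) (by omega))
  have h := rpow_one_add_le_one_add_mul_self (s := q ^ n - 1) (p := 150 / 1000)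
    (by linarith) (by norm_num) (by norm_num)
  rw [add_sub_cancel] at h
  calc (q ^ ((1 : ℝ) / 1000)) ^ (15 * (4 * (2 * (n + 1) - 1)))
      ≤ (q ^ ((1 : ℝ) / 1000)) ^ (n * 150) :=
        pow_le_pow_right₀ (Real.one_le_rpow (by linarith) (by norm_num)) (by omega)
    _ = (q ^ n) ^ ((150 : ℝ) / 1000) := by
        rw [← Real.rpow_natCast, ← Real.rpow_mul (by linarith), ← Real.rpow_natCast q,
          ← Real.rpow_mul (by linarith)]
        push_cast
        ring_nf
    _ < q ^ n - 1 := by linarith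

theorem mul_mul_eq_univ_of_card_le [Fintype F] (hq : 4 ≤ Fintype.card F) {n : ℕ} (hn : 2 ≤ n)
    [DecidableEq F] {H : Subgroup SL(n + 1, F)} (e : H ≃* SL(2, F))
    {S : Finset SL(n + 1, F)} (hsym : S⁻¹ = S) (hgen : Subgroup.closure (S : Set SL(n + 1, F)) = ⊤)
    (hHS : (H : Set SL(n + 1, F)) ⊆ S)
    (hS : ((S ^ 3).card : ℝ) ≤ (Fintype.card F : ℝ) ^ ((1 : ℝ) / 1000) * S.card) :
    S * S * S = Finset.univ := by
  classical
  set q : ℝ := (Fintype.card F : ℝ) with hq_def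
  replace hq : 4 ≤ q := by rw [hq_def]; exact_mod_cast hq
  set K : ℝ := q ^ ((1 : ℝ) / 1000) with hK
  have hK0 : 0 ≤ K := Real.rpow_nonneg (by linarith) _
  have h1S : 1 ∈ S := mod_cast hHS H.one_mem
  have hSpos : (0 : ℝ) < S.card := by exact_mod_cast Finset.card_pos.2 ⟨1, h1S⟩
  let U : Finset SL(n + 1, F) := Finset.univ.filter fun u ↦ ∃ g, ∃ h ∈ H, u = g * h * g⁻¹
  have hmem {u} : u ∈ U ↔ ∃ g, ∃ h ∈ H, u = g * h * g⁻¹ := by simp [U]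
  have h1U : 1 ∈ U := hmem.2 ⟨1, 1, H.one_mem, by simp⟩
  have hUinv : (U : Set SL(n + 1, F))⁻¹ = U := by
    have h {u} (hu : u ∈ U) : u⁻¹ ∈ U := by
      obtain ⟨g, h, hh, rfl⟩ := hmem.1 hu
      exact hmem.2 ⟨g, h⁻¹, H.inv_mem hh, by group⟩
    ext u
    exact ⟨fun hu ↦ inv_inv u ▸ h hu, fun hu ↦ h hu⟩
  have hUconj : ∀ g, ∀ u ∈ U, g * u * g⁻¹ ∈ U := fun g u hu ↦ by
    obtain ⟨x, h, hh, rfl⟩ := hmem.1 hu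
    exact hmem.2 ⟨g * x, h, hh, by group⟩
  have hUS : U ⊆ S ^ 6 := fun u hu ↦ by
    obtain ⟨g, h, hh, rfl⟩ := hmem.1 hu
    exact (isQuasirandom_SL2.of_mulEquiv e.symm).conj_mem_pow_six hHS hsym hgen hS
      (Real.rpow_inv_thousand_pow_lt hq) g hh
  obtain ⟨a, ha, hac⟩ := exists_mem_notMem_center_of_mulEquiv_SL2 e
  have hUpow : U ^ (4 * (2 * (n + 1) - 1)) = Finset.univ := by
    refine Finset.eq_univ_of_forall fun g ↦ ?_
    have h1 := mem_pow_of_forall_vecTransvection_mem (by omega) (Set.one_mem_pow h1U)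
      (vecTransvection_mem_pow (by omega) h1U hUinv hUconj
        (hmem.2 ⟨1, a, ha, by simp⟩) hac) g
    rw [← pow_mul] at h1
    exact_mod_cast h1
  have hUSc : ((U * S).card : ℝ) ≤ K ^ 5 * S.card := by
    refine le_trans ?_ (Finset.small_pow_of_small_tripling (m := 7) (by norm_num) hS hsym)
    rw [pow_succ]
    exact_mod_cast Finset.card_le_card (Finset.mul_subset_mul_right hUS)
  have hcard := card_le_pow_mul_card_of_pow_eq_univ ⟨1, h1S⟩ hUconj hUSc hUpow
  refine (isQuasirandom_SL hn).mul_mul_eq_univ S S S ?_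
  calc (Fintype.card SL(n + 1, F) : ℝ) ^ 3
      ≤ ((K ^ 5) ^ (4 * (2 * (n + 1) - 1)) * S.card) ^ 3 :=
        pow_le_pow_left₀ (Nat.cast_nonneg _) hcard 3
    _ = K ^ (15 * (4 * (2 * (n + 1) - 1))) * (S.card * S.card * S.card) := by
        rw [mul_pow, ← pow_mul, ← pow_mul]
        ring_nf
    _ < _ := mul_lt_mul_of_pos_right (Real.rpow_inv_thousand_pow_lt_pow_sub_one hq hn)
        (by positivity)

end BabyProduct

/-- **Baby Product theorem** (Pyber–Szabó): let `q ≥ 4` be a prime power (realised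
as the order of a finite field `F`), `n ≥ 2`, `G = SL(n,q)`, and let `H ≤ G` be a
subgroup isomorphic to `SL(2,q)`. If `S` is a symmetric generating set of `G`
containing `H`, then either `S³ = G` or `|S³| > |S| · q^(1/1000)`. -/
theorem baby_product_theorem (n : ℕ) (hn : 2 ≤ n) (F : Type) [Field F] [Fintype F]
    (hq : 4 ≤ Fintype.card F)
    (H : Subgroup (Matrix.SpecialLinearGroup (Fin n) F))
    (hiso : Nonempty (H ≃* Matrix.SpecialLinearGroup (Fin 2) F))
    (S : Set (Matrix.SpecialLinearGroup (Fin n) F))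
    (hsym : S = S⁻¹) (hgen : Subgroup.closure S = ⊤)
    (hHS : (H : Set (Matrix.SpecialLinearGroup (Fin n) F)) ⊆ S) :
    S * S * S = Set.univ ∨
      (Nat.card ↥S : ℝ) * (Fintype.card F : ℝ) ^ ((1 : ℝ) / 1000) <
        (Nat.card ↥(S * S * S) : ℝ) := by

  classical
  obtain ⟨e⟩ := hiso
  obtain rfl | hn3 := hn.eq_or_lt
  · left
    have hH : H = ⊤ := Subgroup.eq_top_of_card_eq _ (Nat.card_congr e.toEquiv)
    have hS : S = Set.univ := Set.univ_subset_iff.1 (by simpa [hH] using hHS)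
    simp [hS]
  obtain ⟨m, rfl⟩ : ∃ m, n = m + 1 := ⟨n - 1, by omega⟩
  lift S to Finset (Matrix.SpecialLinearGroup (Fin (m + 1)) F) using S.toFinite
  rw [or_iff_not_imp_right, not_lt, ← Finset.coe_mul, ← Finset.coe_mul, Nat.card_coe_set_eq,
    Nat.card_coe_set_eq, Set.ncard_coe_finset, Set.ncard_coe_finset]
  intro hle
  rw [mul_mul_eq_univ_of_card_le hq (by omega) e (by exact_mod_cast hsym.symm) hgen hHS
    (by rwa [pow_succ, pow_two, mul_comm (_ ^ _)]), Finset.coe_univ]
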